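/- Let u ∈ C²(Ω̄) and fix i, j ∈ {1, …, D}. Then (H²_n u)_{i,j} → (Hu)_{i,j} = ∂²u/∂x_i∂x_j locally uniformly on Ω as n → ∞. If moreover u ∈ C²_c(Ω), the convergence is uniform on Ω. -/

import Mathlib

open MeasureTheory Filter Topology Metric

noncomputable section

abbrev Euc (D : ℕ) := EuclideanSpace ℝ (Fin D)

/-- The standing hypotheses on the sequence of radial kernels `ρ n`. -/
structure IsKernelSeq (D : ℕ) (ρ : ℕ → Euc D → ℝ) : Prop where
  nonneg : ∀ n x, 0 ≤ ρ n x
  radial : ∀ n x y, ‖x‖ = ‖y‖ → ρ n x = ρ n y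
  integral_one : ∀ n, ∫ x, ρ n x = 1
  tail : ∀ δ : ℝ, 0 < δ →
    Tendsto (fun n => ∫ x in {x : Euc D | δ < ‖x‖}, ρ n x) atTop (nhds 0)

/-- A bounded, connected, simply connected open domain. -/
structure NiceDomain (D : ℕ) (Ω : Set (Euc D)) : Prop where
  isOpen : IsOpen Ω
  bounded : Bornology.IsBounded Ω
  connected : IsConnected Ω
  simplyConnected : SimplyConnectedSpace Ω

/-- The `i`-th component of the nonlocal gradient of `f` over `Ω` with kernel `ρ`. -/
def nlDeriv (D : ℕ) (Ω : Set (Euc D)) (ρ : Euc D → ℝ) (f : Euc D → ℝ) (i : Fin D)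
    (x : Euc D) : ℝ :=
  (D : ℝ) * ∫ y in Ω, (f x - f y) / ‖x - y‖ ^ 2 * (x i - y i) * ρ (x - y)

/-- The classical partial derivative `∂f/∂x_j`. -/
def partialDeriv (D : ℕ) (f : Euc D → ℝ) (j : Fin D) (x : Euc D) : ℝ :=
  fderiv ℝ f x (EuclideanSpace.single j 1)

section helpers

variable {D : ℕ}

lemma abs_coord_le (z : Euc D) (k : Fin D) : |z k| ≤ ‖z‖ := by
  have := PiLp.norm_apply_le z k
  simpa using this

lemma weight_integrable {r : Euc D → ℝ} (hr : Integrable r) (k j : Fin D) :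
    Integrable (fun z : Euc D => z k * z j / ‖z‖ ^ 2 * r z) := by
  refine hr.bdd_mul (c := 1) ?_ ?_
  · apply Measurable.aestronglyMeasurable
    fun_prop
  · refine Eventually.of_forall fun z => ?_
    rw [Real.norm_eq_abs, abs_div, abs_mul, abs_of_nonneg (sq_nonneg ‖z‖)]
    apply div_le_one_of_le₀ _ (sq_nonneg _)
    rw [sq]
    exact mul_le_mul (abs_coord_le z k) (abs_coord_le z j) (abs_nonneg _) (norm_nonneg _)

lemma weight_offdiag {r : Euc D → ℝ} (hrad : ∀ x y, ‖x‖ = ‖y‖ → r x = r y) (k j : Fin D)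
    (hkj : k ≠ j) : ∫ z : Euc D, z k * z j / ‖z‖ ^ 2 * r z = 0 := by
  let e : Euc D ≃ₗᵢ[ℝ] Euc D := LinearIsometryEquiv.piLpCongrRight 2
    (fun l : Fin D => if l = k then LinearIsometryEquiv.neg ℝ else LinearIsometryEquiv.refl ℝ ℝ)
  have h := e.measurePreserving.integral_comp e.toHomeomorph.measurableEmbedding
    (fun z : Euc D => z k * z j / ‖z‖ ^ 2 * r z)
  have h1 : ∀ z, (e z) k = - z k := by
    intro z; simp [e]
  have h2 : ∀ z, (e z) j = z j := by
    intro z; simp [e, hkj.symm]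
  have h3 : ∀ z, r (e z) = r z := fun z => hrad _ _ (e.norm_map z)
  simp only [h1, h2, h3, e.norm_map] at h
  have h4 : ∫ z : Euc D, -z k * z j / ‖z‖ ^ 2 * r z
      = - ∫ z : Euc D, z k * z j / ‖z‖ ^ 2 * r z := by
    rw [← integral_neg]
    congr 1; ext z; ring
  rw [h4] at h
  linarith

lemma weight_diag_eq {r : Euc D → ℝ} (hrad : ∀ x y, ‖x‖ = ‖y‖ → r x = r y) (k j : Fin D) :
    ∫ z : Euc D, z k * z k / ‖z‖ ^ 2 * r z = ∫ z : Euc D, z j * z j / ‖z‖ ^ 2 * r z := by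
  let e : Euc D ≃ₗᵢ[ℝ] Euc D := LinearIsometryEquiv.piLpCongrLeft 2 ℝ ℝ (Equiv.swap k j)
  have h := e.measurePreserving.integral_comp e.toHomeomorph.measurableEmbedding
    (fun z : Euc D => z j * z j / ‖z‖ ^ 2 * r z)
  have h1 : ∀ z, (e z) j = z k := by
    intro z; simp [e, LinearIsometryEquiv.piLpCongrLeft_apply, Equiv.piCongrLeft']
  have h3 : ∀ z, r (e z) = r z := fun z => hrad _ _ (e.norm_map z)
  simpa only [h1, h3, e.norm_map] using h

lemma weight_diag (hD : 0 < D) {r : Euc D → ℝ} (hr : Integrable r)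
    (hrad : ∀ x y, ‖x‖ = ‖y‖ → r x = r y) (h1 : ∫ x, r x = 1) (j : Fin D) :
    (D : ℝ) * ∫ z : Euc D, z j * z j / ‖z‖ ^ 2 * r z = 1 := by
  haveI : Nonempty (Fin D) := ⟨j⟩
  have hs : ∑ k : Fin D, ∫ z : Euc D, z k * z k / ‖z‖ ^ 2 * r z = 1 := by
    rw [← integral_finsetSum _ (fun k _ => weight_integrable hr k k), ← h1]
    apply integral_congr_ae
    have : ∀ᵐ z : Euc D, z ≠ 0 := by
      simp [ae_iff]
    filter_upwards [this] with z hz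
    rw [← Finset.sum_mul, ← Finset.sum_div]
    have : ∑ k : Fin D, z k * z k = ‖z‖ ^ 2 := by
      rw [EuclideanSpace.real_norm_sq_eq]; simp [sq]
    rw [this, div_self (by positivity), one_mul]
  rw [Finset.sum_congr rfl (fun k _ => weight_diag_eq hrad k j)] at hs
  simpa using hs

lemma clm_apply_eq_sum (g : Euc D →L[ℝ] ℝ) (z : Euc D) :
    g z = ∑ k, z k * g (EuclideanSpace.single k 1) := by
  conv_lhs => rw [← (EuclideanSpace.basisFun (Fin D) ℝ).sum_repr z]
  simp

lemma lin_weight_eq (g : Euc D →L[ℝ] ℝ) (r : Euc D → ℝ) (j : Fin D) :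
    (fun z : Euc D => g z / ‖z‖ ^ 2 * z j * r z)
      = fun z => ∑ k, g (EuclideanSpace.single k 1) * (z k * z j / ‖z‖ ^ 2 * r z) := by
  ext z
  rw [clm_apply_eq_sum g z, Finset.sum_div, Finset.sum_mul, Finset.sum_mul]
  refine Finset.sum_congr rfl fun k _ => ?_
  ring

lemma lin_weight_integrable {r : Euc D → ℝ} (hr : Integrable r) (g : Euc D →L[ℝ] ℝ) (j : Fin D) :
    Integrable (fun z : Euc D => g z / ‖z‖ ^ 2 * z j * r z) := by
  rw [lin_weight_eq]
  exact integrable_finsetSum _ fun k _ => (weight_integrable hr k j).const_mul _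

lemma lin_weight (hD : 0 < D) {r : Euc D → ℝ} (hr : Integrable r)
    (hrad : ∀ x y, ‖x‖ = ‖y‖ → r x = r y) (h1 : ∫ x, r x = 1) (g : Euc D →L[ℝ] ℝ) (j : Fin D) :
    (D : ℝ) * ∫ z : Euc D, g z / ‖z‖ ^ 2 * z j * r z = g (EuclideanSpace.single j 1) := by
  rw [lin_weight_eq, integral_finsetSum _ fun k _ => (weight_integrable hr k j).const_mul _]
  simp_rw [integral_const_mul]
  rw [Finset.sum_eq_single j]
  · rw [mul_left_comm, weight_diag hD hr hrad h1, mul_one]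
  · intro k _ hk
    rw [weight_offdiag hrad k j hk, mul_zero]
  · simp

/-- Main quantitative estimate. -/
lemma key_estimate (hD : 0 < D) {Ω : Set (Euc D)} (hΩ : MeasurableSet Ω) {r : Euc D → ℝ}
    (hr0 : ∀ x, 0 ≤ r x)
    (hrad : ∀ x y, ‖x‖ = ‖y‖ → r x = r y) (h1 : ∫ x, r x = 1)
    {f : Euc D → ℝ} (hf : AEStronglyMeasurable f (volume.restrict Ω)) {M : ℝ}
    (hM : ∀ y ∈ Ω, |f y| ≤ M) (j : Fin D) (x : Euc D) (hx : x ∈ Ω) (g : Euc D →L[ℝ] ℝ) {G : ℝ}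
    (hG : ‖g‖ ≤ G) {ε δ : ℝ} (hε : 0 ≤ ε) (hδ : 0 < δ)
    (happ : ∀ y, ‖x - y‖ ≤ δ →
      |Ω.indicator (fun y => f x - f y) y - g (x - y)| ≤ ε * ‖x - y‖) :
    |nlDeriv D Ω r f j x - g (EuclideanSpace.single j 1)| ≤
      D * (ε + (2 * M / δ + G) * ∫ z in {z : Euc D | δ < ‖z‖}, r z) := by
  have hr : Integrable r := by
    by_contra h
    rw [integral_undef h] at h1
    exact zero_ne_one h1
  have hM0 : 0 ≤ M := (abs_nonneg _).trans (hM x hx)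
  have hG0 : 0 ≤ G := (norm_nonneg _).trans hG
  have hms : MeasurableSet {z : Euc D | δ < ‖z‖} := measurableSet_lt (by fun_prop) (by fun_prop)
  set F : Euc D → ℝ := Ω.indicator (fun y => f x - f y) with hF
  have hFm : AEStronglyMeasurable F := by
    rw [hF, aestronglyMeasurable_indicator_iff hΩ]
    exact aestronglyMeasurable_const.sub hf
  have hFb : ∀ y, |F y| ≤ 2 * M := by
    intro y
    by_cases hy : y ∈ Ω
    · rw [hF, Set.indicator_of_mem hy]
      have := abs_sub (f x) (f y)
      linarith [hM x hx, hM y hy]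
    · rw [hF, Set.indicator_of_notMem hy]; simp [hM0]
  -- the difference integrand
  set Φ : Euc D → ℝ := fun y => (F y - g (x - y)) / ‖x - y‖ ^ 2 * (x j - y j) * r (x - y) with hΦ
  set B : Euc D → ℝ := fun z => ε * r z
    + (2 * M / δ + G) * {z : Euc D | δ < ‖z‖}.indicator r z with hB
  have hBi : Integrable B := (hr.const_mul _).add ((hr.indicator hms).const_mul _)
  have hrx : Integrable (fun y => r (x - y)) := hr.comp_sub_left x
  have hΦB : ∀ y, |Φ y| ≤ B (x - y) := by
    intro y
    have hc : |x j - y j| ≤ ‖x - y‖ := by simpa using abs_coord_le (x - y) j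
    have hr' := hr0 (x - y)
    have hK : 0 ≤ 2 * M / δ + G := by positivity
    simp only [hΦ, hB, abs_mul, abs_div, abs_of_nonneg hr', abs_of_nonneg (sq_nonneg ‖x - y‖)]
    have hind : 0 ≤ {z : Euc D | δ < ‖z‖}.indicator r (x - y) :=
      Set.indicator_nonneg (fun z _ => hr0 z) _
    rcases eq_or_lt_of_le (norm_nonneg (x - y)) with h0 | h0
    · rw [← h0]; simp only [ne_eq, OfNat.ofNat_ne_zero, not_false_eq_true, zero_pow, div_zero,
        zero_mul]; positivity
    rcases le_or_gt ‖x - y‖ δ with hle | hlt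
    · have h2 : |F y - g (x - y)| / ‖x - y‖ ^ 2 * |x j - y j| ≤ ε := by
        rw [div_mul_eq_mul_div, div_le_iff₀ (by positivity)]
        calc _ ≤ (ε * ‖x - y‖) * ‖x - y‖ :=
              mul_le_mul (happ y hle) hc (abs_nonneg _) (by positivity)
          _ = _ := by ring
      have := mul_le_mul_of_nonneg_right h2 hr'
      nlinarith [mul_nonneg hK hind]
    · rw [Set.indicator_of_mem (by exact hlt)]
      have h3 : |F y - g (x - y)| ≤ (2 * M / δ + G) * ‖x - y‖ := by
        have h4 : |g (x - y)| ≤ G * ‖x - y‖ :=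
          (g.le_opNorm _).trans (mul_le_mul_of_nonneg_right hG (norm_nonneg _))
        have h5 : 2 * M ≤ 2 * M / δ * ‖x - y‖ := by
          rw [div_mul_eq_mul_div, le_div_iff₀ hδ]
          exact mul_le_mul_of_nonneg_left hlt.le (by positivity)
        have := abs_sub (F y) (g (x - y))
        linarith [hFb y]
      have h2 : |F y - g (x - y)| / ‖x - y‖ ^ 2 * |x j - y j| ≤ 2 * M / δ + G := by
        rw [div_mul_eq_mul_div, div_le_iff₀ (by positivity)]
        calc _ ≤ ((2 * M / δ + G) * ‖x - y‖) * ‖x - y‖ :=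
              mul_le_mul h3 hc (abs_nonneg _) (by positivity)
          _ = _ := by ring
      have := mul_le_mul_of_nonneg_right h2 hr'
      nlinarith [mul_nonneg hε hr']
  have hΦi : Integrable Φ := by
    refine (hBi.comp_sub_left x).mono' ?_ (Eventually.of_forall hΦB)
    refine AEStronglyMeasurable.mul (AEStronglyMeasurable.mul ?_ ?_) hrx.aestronglyMeasurable
    · simp_rw [div_eq_mul_inv]
      refine (hFm.sub ?_).mul ?_ <;> exact Measurable.aestronglyMeasurable (by fun_prop)
    · exact Measurable.aestronglyMeasurable (by fun_prop)
  have hgi := (lin_weight_integrable hr g j).comp_sub_left x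
  have e1 : g (EuclideanSpace.single j 1)
      = (D : ℝ) * ∫ y, g (x - y) / ‖x - y‖ ^ 2 * (x - y) j * r (x - y) := by
    rw [← lin_weight hD hr hrad h1 g j]
    rw [integral_sub_left_eq_self (fun z : Euc D => g z / ‖z‖ ^ 2 * z j * r z) volume x]
  have e2 : nlDeriv D Ω r f j x
      = (D : ℝ) * ∫ y, F y / ‖x - y‖ ^ 2 * (x j - y j) * r (x - y) := by
    rw [nlDeriv, ← integral_indicator hΩ]
    congr 2; ext y
    by_cases hy : y ∈ Ω <;> simp [hF, hy]
  have e3 : ∫ y, F y / ‖x - y‖ ^ 2 * (x j - y j) * r (x - y)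
      = (∫ y, Φ y) + ∫ y, g (x - y) / ‖x - y‖ ^ 2 * (x - y) j * r (x - y) := by
    rw [← integral_add hΦi hgi]
    congr 1; ext y
    simp only [hΦ, PiLp.sub_apply]
    ring
  rw [e2, e3, e1, mul_add, add_sub_cancel_right, abs_mul, abs_of_nonneg (Nat.cast_nonneg D)]
  refine mul_le_mul_of_nonneg_left ?_ (Nat.cast_nonneg D)
  have hle : ‖∫ y, Φ y‖ ≤ ∫ y, B (x - y) :=
    norm_integral_le_of_norm_le (hBi.comp_sub_left x) (Eventually.of_forall hΦB)
  calc |∫ y, Φ y| ≤ ∫ y, B (x - y) := hle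
    _ = ∫ z, B z := integral_sub_left_eq_self B volume x
    _ = _ := by
      rw [hB, integral_add (hr.const_mul _) ((hr.indicator hms).const_mul _),
        integral_const_mul, integral_const_mul, h1, integral_indicator hms, mul_one]

/-- Uniform convergence from uniform first-order approximation. -/
lemma key_tendsto (hD : 0 < D) {Ω : Set (Euc D)} (hΩ : MeasurableSet Ω)
    {ρ : ℕ → Euc D → ℝ} (hρ : IsKernelSeq D ρ)
    {f : Euc D → ℝ} (hf : AEStronglyMeasurable f (volume.restrict Ω)) {M : ℝ}
    (hM : ∀ y ∈ Ω, |f y| ≤ M) (j : Fin D) {S : Set (Euc D)} (hS : S ⊆ Ω)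
    (g : Euc D → Euc D →L[ℝ] ℝ) {G : ℝ} (hG : ∀ x ∈ S, ‖g x‖ ≤ G)
    (happ : ∀ ε > 0, ∃ δ > 0, ∀ x ∈ S, ∀ y, ‖x - y‖ ≤ δ →
      |Ω.indicator (fun y => f x - f y) y - g x (x - y)| ≤ ε * ‖x - y‖) :
    TendstoUniformlyOn (fun n x => nlDeriv D Ω (ρ n) f j x)
      (fun x => g x (EuclideanSpace.single j 1)) atTop S := by
  rw [Metric.tendstoUniformlyOn_iff]
  intro η hη
  have hD' : (0 : ℝ) < D := by exact_mod_cast hD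
  obtain ⟨δ, hδ, hap⟩ := happ (η / (2 * D)) (by positivity)
  have ht : Tendsto (fun n => (D : ℝ) * (η / (2 * D) + (2 * M / δ + G) *
      ∫ z in {z : Euc D | δ < ‖z‖}, ρ n z)) atTop
      (𝓝 ((D : ℝ) * (η / (2 * D) + (2 * M / δ + G) * 0))) :=
    (((hρ.tail δ hδ).const_mul _).const_add _).const_mul _
  have hlt : (D : ℝ) * (η / (2 * D) + (2 * M / δ + G) * 0) < η := by
    have : (D : ℝ) * (η / (2 * D) + (2 * M / δ + G) * 0) = η / 2 := by field_simp; ring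
    linarith
  filter_upwards [ht.eventually_lt_const hlt] with n hn x hx
  rw [dist_comm, Real.dist_eq]
  exact (key_estimate hD hΩ (hρ.nonneg n) (hρ.radial n) (hρ.integral_one n) hf hM j x (hS hx)
    (g x) (hG x hx) (by positivity) hδ (hap x hx)).trans_lt hn

/-- First-order approximation from closeness of derivatives on a ball. -/
lemma taylor_ball {f : Euc D → ℝ} {x y : Euc D} {ε δ : ℝ} (hxy : ‖x - y‖ ≤ δ)
    (hd : ∀ z, dist x z ≤ δ → DifferentiableAt ℝ f z)
    (hc : ∀ z, dist x z ≤ δ → ‖fderiv ℝ f z - fderiv ℝ f x‖ ≤ ε) :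
    |f x - f y - fderiv ℝ f x (x - y)| ≤ ε * ‖x - y‖ := by
  have h0 : 0 ≤ δ := (norm_nonneg _).trans hxy
  refine Convex.norm_image_sub_le_of_norm_fderiv_le' (s := closedBall x δ) (𝕜 := ℝ)
    (fun z hz => hd z ?_) (fun z hz => hc z ?_) (convex_closedBall x δ) ?_ (mem_closedBall_self h0)
  · rwa [dist_comm]
  · rwa [dist_comm]
  · rwa [mem_closedBall, dist_comm, dist_eq_norm]

/-- The gradient of a `C²(closure Ω)` function is bounded on `Ω`. -/
lemma grad_bounded {Ω : Set (Euc D)} (ho : IsOpen Ω) (hb : Bornology.IsBounded Ω)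
    {u : Euc D → ℝ} (hu : ContDiffOn ℝ 2 u (closure Ω)) :
    ∃ M, ∀ y ∈ Ω, ‖fderiv ℝ u y‖ ≤ M := by
  have hK : IsCompact (closure Ω) := hb.isCompact_closure
  have : ∃ M, ∀ y ∈ closure Ω ∩ Ω, ‖fderiv ℝ u y‖ ≤ M := by
    refine hK.induction_on (p := fun s => ∃ M, ∀ y ∈ s ∩ Ω, ‖fderiv ℝ u y‖ ≤ M) ?_ ?_ ?_ ?_
    · exact ⟨0, by simp⟩
    · rintro s t hst ⟨M, hM⟩
      exact ⟨M, fun y hy => hM y ⟨hst hy.1, hy.2⟩⟩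
    · rintro s t ⟨M, hM⟩ ⟨N, hN⟩
      refine ⟨max M N, fun y hy => ?_⟩
      rcases hy.1 with h | h
      · exact (hM y ⟨h, hy.2⟩).trans (le_max_left _ _)
      · exact (hN y ⟨h, hy.2⟩).trans (le_max_right _ _)
    · intro x hx
      have h1 : ContDiffWithinAt ℝ (1 + 1) u (closure Ω) x := by
        exact (hu x hx).of_le one_add_one_eq_two.le
      obtain ⟨v, hv, -, f', hf', hcd⟩ :=
        (contDiffWithinAt_succ_iff_hasFDerivWithinAt (by simp)).1 h1
      rw [Set.insert_eq_of_mem hx] at hv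
      have hcont := hcd.continuousWithinAt
      have hev : ∀ᶠ y in 𝓝[v] x, ‖f' y‖ < ‖f' x‖ + 1 :=
        hcont.norm.eventually_lt_const (by linarith)
      have hle : 𝓝[closure Ω] x ≤ 𝓝[v] x := nhdsWithin_le_of_mem hv
      obtain ⟨w, hwo, hxw, hwv⟩ := mem_nhdsWithin.1 hv
      refine ⟨(w ∩ closure Ω) ∩ {y | ‖f' y‖ < ‖f' x‖ + 1}, inter_mem
        (inter_mem (mem_nhdsWithin_of_mem_nhds (hwo.mem_nhds hxw)) self_mem_nhdsWithin)
        (hle hev), ‖f' x‖ + 1, ?_⟩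
      rintro y ⟨⟨⟨hyw, hyc⟩, hyb⟩, hyΩ⟩
      have hvy : v ∈ 𝓝 y := by
        filter_upwards [hwo.mem_nhds hyw, ho.mem_nhds hyΩ] with z hz hz'
        exact hwv ⟨hz, subset_closure hz'⟩
      have := ((hf' y (hwv ⟨hyw, hyc⟩)).hasFDerivAt hvy).fderiv
      rw [this]
      exact le_of_lt hyb
  obtain ⟨M, hM⟩ := this
  exact ⟨M, fun y hy => hM y ⟨subset_closure hy, hy⟩⟩

end helpers

/-- for `u ∈ C²(Ω̄)`, the mixed nonlocal Hessian entry
`(H²_n u)_{i,j} = (u_{x_i})^n_{x_j}` converges locally uniformly on `Ω` to the classical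
Hessian entry `∂²u/∂x_i∂x_j` as `n → ∞`; if moreover `u ∈ C²_c(Ω)` the convergence is
uniform on `Ω`. -/
theorem H2_tendsto_H
    (D : ℕ) (hD : 0 < D) (Ω : Set (Euc D)) (hΩ : NiceDomain D Ω)
    (ρ : ℕ → Euc D → ℝ) (hρ : IsKernelSeq D ρ)
    (u : Euc D → ℝ) (hu : ContDiffOn ℝ 2 u (closure Ω))
    (i j : Fin D) :
    TendstoLocallyUniformlyOn
      (fun n x => nlDeriv D Ω (ρ n) (partialDeriv D u i) j x)
      (fun x => partialDeriv D (partialDeriv D u i) j x) atTop Ω ∧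
    (ContDiff ℝ 2 u → HasCompactSupport u → tsupport u ⊆ Ω →
      TendstoUniformlyOn
        (fun n x => nlDeriv D Ω (ρ n) (partialDeriv D u i) j x)
        (fun x => partialDeriv D (partialDeriv D u i) j x) atTop Ω) := by
  have ho := hΩ.isOpen
  set f := partialDeriv D u i with hf
  have huΩ : ContDiffOn ℝ 2 u Ω := hu.mono subset_closure
  have hfΩ : ∀ x ∈ Ω, ContDiffAt ℝ 1 f x := by
    intro x hx
    have h2 : ContDiffAt ℝ 2 u x := huΩ.contDiffAt (ho.mem_nhds hx)
    have h3 : ContDiffAt ℝ 1 (fderiv ℝ u) x :=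
      h2.fderiv_right (by rw [one_add_one_eq_two])
    exact h3.clm_apply contDiffAt_const
  have hfm : AEStronglyMeasurable f (volume.restrict Ω) :=
    ContinuousOn.aestronglyMeasurable
      (fun x hx => (hfΩ x hx).continuousAt.continuousWithinAt) ho.measurableSet
  have hf'c : ∀ x ∈ Ω, ContinuousAt (fderiv ℝ f) x := by
    intro x hx
    have h3 : ContDiffAt ℝ 0 (fderiv ℝ f) x := (hfΩ x hx).fderiv_right (by simp)
    exact h3.continuousAt
  obtain ⟨M, hM⟩ := grad_bounded ho hΩ.bounded hu
  have hfM : ∀ y ∈ Ω, |f y| ≤ M := by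
    intro y hy
    have h := (fderiv ℝ u y).le_opNorm (EuclideanSpace.single i 1)
    simp only [PiLp.norm_single, norm_one, mul_one] at h
    exact h.trans (hM y hy)
  constructor
  · rw [tendstoLocallyUniformlyOn_iff_forall_isCompact ho]
    intro K hKΩ hK
    obtain ⟨G, hG⟩ := hK.exists_bound_of_continuousOn
      (fun x hx => (hf'c x (hKΩ hx)).continuousWithinAt)
    refine key_tendsto hD ho.measurableSet hρ hfm hfM j hKΩ (fderiv ℝ f) hG ?_
    intro ε hε
    obtain ⟨δ₁, hδ₁, hsub⟩ := hK.exists_cthickening_subset_open ho hKΩ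
    obtain ⟨δ₂, hδ₂, hunif⟩ := Metric.mem_uniformity_dist.1
      (hK.uniformContinuousAt_of_continuousAt (fderiv ℝ f) (fun a ha => hf'c a (hKΩ ha))
        (Metric.dist_mem_uniformity hε))
    refine ⟨min δ₁ (δ₂ / 2), by positivity, fun x hx y hxy => ?_⟩
    have hin : ∀ z, dist x z ≤ min δ₁ (δ₂ / 2) → z ∈ Ω := fun z hz =>
      hsub (mem_cthickening_of_dist_le z x δ₁ K hx
        (by rw [dist_comm]; exact hz.trans (min_le_left _ _)))
    rw [Set.indicator_of_mem (hin y (by rwa [dist_eq_norm]))]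
    refine taylor_ball hxy
      (fun z hz => (hfΩ z (hin z hz)).differentiableAt (by simp)) (fun z hz => ?_)
    have h : dist x z < δ₂ := (hz.trans (min_le_right _ _)).trans_lt (by linarith)
    have := hunif h hx
    simp only [Set.mem_setOf_eq] at this
    rw [← dist_eq_norm, dist_comm]
    exact this.le
  · intro hu2 hcs hsupp
    have hfC : ContDiff ℝ 1 f := by
      have h3 : ContDiff ℝ 1 (fderiv ℝ u) := hu2.fderiv_right (by rw [one_add_one_eq_two])
      exact h3.clm_apply contDiff_const
    have hfcs : HasCompactSupport f := hcs.fderiv_apply ℝ _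
    have hf' : Continuous (fderiv ℝ f) := hfC.continuous_fderiv (by simp)
    have hf'cs : HasCompactSupport (fderiv ℝ f) := hfcs.fderiv ℝ
    have hf0 : ∀ x, x ∉ tsupport u → f x = 0 := by
      intro x hx
      have : fderiv ℝ u x = 0 := by
        by_contra h
        exact hx (support_fderiv_subset ℝ h)
      simp [hf, partialDeriv, this]
    have hts : tsupport f ⊆ tsupport u := by
      refine closure_minimal (fun x hx => ?_) (isClosed_tsupport u)
      by_contra h
      exact hx (hf0 x h)
    have hf'0 : ∀ x, x ∉ tsupport u → fderiv ℝ f x = 0 := by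
      intro x hx
      by_contra h
      exact hx (hts (support_fderiv_subset ℝ h))
    obtain ⟨G, hG⟩ := hf'cs.exists_bound_of_continuous hf'
    refine key_tendsto hD ho.measurableSet hρ hfm hfM j subset_rfl (fderiv ℝ f)
      (fun x _ => hG x) ?_
    intro ε hε
    have hcomp : IsCompact (tsupport u) := hcs
    obtain ⟨δ₁, hδ₁, hsub⟩ := hcomp.exists_cthickening_subset_open ho hsupp
    obtain ⟨δ₂, hδ₂, hunif⟩ := Metric.uniformContinuous_iff.1
      (hf'cs.uniformContinuous_of_continuous hf') ε hε
    refine ⟨min δ₁ (δ₂ / 2), by positivity, fun x hx y hxy => ?_⟩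
    by_cases hy : y ∈ Ω
    · rw [Set.indicator_of_mem hy]
      refine taylor_ball hxy
        (fun z hz => hfC.differentiable (by simp) z) (fun z hz => ?_)
      have h : dist x z < δ₂ := (hz.trans (min_le_right _ _)).trans_lt (by linarith)
      rw [← dist_eq_norm, dist_comm]
      exact (hunif h).le
    · rw [Set.indicator_of_notMem hy]
      have hxs : x ∉ tsupport u := by
        intro h
        refine hy (hsub (mem_cthickening_of_dist_le y x δ₁ _ h ?_))
        rw [dist_comm, dist_eq_norm]
        exact hxy.trans (min_le_left _ _)
      rw [hf'0 x hxs]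
      simp only [ContinuousLinearMap.zero_apply, sub_zero, abs_zero]
      positivity

end
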